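/- arXiv:2101.09175 — 7 statements merged into one kernel-verified Lean document; each statement's English description precedes it below -/
import Mathlib

section
/- Let H be a real Hilbert space, let f : H → ℝ be convex and differentiable with 1-Lipschitz gradient ∇f, let g : H → ℝ be convex, and set E := f + g. Let U ⊆ H be a nonempty closed convex set, let x̄ ∈ H, and suppose x ∈ U minimizes the function u ↦ ½‖u − x̄ + ∇f(x̄)‖² + g(u) over U. Then for every z ∈ U one has E(x) + ½‖x − z‖² ≤ E(z) + ½‖x̄ − z‖². -/
open scoped RealInnerProductSpace

lemma aux_deriv {H : Type*} [NormedAddCommGroup H] [InnerProductSpace ℝ H] [CompleteSpace H]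
    (f : H → ℝ) (f' : H → H) (hf' : ∀ u, HasGradientAt f (f' u) u) (a d : H) (t : ℝ) :
    HasDerivAt (fun t : ℝ => f (a + t • d)) ⟪f' (a + t • d), d⟫ t := by
  have h1 : HasDerivAt (fun t : ℝ => a + t • d) d t := by
    simpa using ((hasDerivAt_id t).smul_const d).const_add a
  have h2 := (hf' (a + t • d)).hasFDerivAt.comp_hasDerivAt t h1
  simpa [Function.comp_def] using h2

lemma aux_lower {H : Type*} [NormedAddCommGroup H] [InnerProductSpace ℝ H] [CompleteSpace H]
    (f : H → ℝ) (f' : H → H) (hf' : ∀ u, HasGradientAt f (f' u) u)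
    (hc : ConvexOn ℝ Set.univ f) (a d : H) : f a + ⟪f' a, d⟫ ≤ f (a + d) := by
  have hφ : ConvexOn ℝ Set.univ (fun t : ℝ => f (a + t • d)) := by
    refine ⟨convex_univ, fun s _ t _ α β hα hβ hab => ?_⟩
    have := hc.2 (Set.mem_univ (a + s • d)) (Set.mem_univ (a + t • d)) hα hβ hab
    convert this using 2
    have ha : a = α • a + β • a := by rw [← add_smul, hab, one_smul]
    simp only [smul_eq_mul]
    nth_rewrite 1 [ha]
    module
  have := hφ.le_slope_of_hasDerivAt (Set.mem_univ 0) (Set.mem_univ 1) one_pos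
    (aux_deriv f f' hf' a d 0)
  simp [slope_def_field] at this
  linarith

lemma aux_upper {H : Type*} [NormedAddCommGroup H] [InnerProductSpace ℝ H] [CompleteSpace H]
    (f : H → ℝ) (f' : H → H) (hf' : ∀ u, HasGradientAt f (f' u) u)
    (hl : LipschitzWith 1 f') (a d : H) :
    f (a + d) ≤ f a + ⟪f' a, d⟫ + (1/2) * ‖d‖^2 := by
  have hd : ∀ t : ℝ, HasDerivAt (fun t : ℝ => f (a + t • d) - (t * ⟪f' a, d⟫ + t^2 * ((1/2) * ‖d‖^2)))
      (⟪f' (a + t • d), d⟫ - (⟪f' a, d⟫ + t * ‖d‖^2)) t := by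
    intro t
    refine (aux_deriv f f' hf' a d t).sub ?_
    have h := ((hasDerivAt_id t).mul_const ⟪f' a, d⟫).add
      ((hasDerivAt_pow 2 t).mul_const ((1/2) * ‖d‖^2))
    refine h.congr_deriv ?_
    push_cast
    ring
  have hanti := antitoneOn_of_deriv_nonpos (convex_Icc (0:ℝ) 1)
    (fun t _ => (hd t).continuousAt.continuousWithinAt)
    (fun t _ => (hd t).differentiableAt.differentiableWithinAt) (by
      intro t ht
      rw [interior_Icc] at ht
      rw [(hd t).deriv]
      have h1 : ⟪f' (a + t • d) - f' a, d⟫ ≤ ‖f' (a + t • d) - f' a‖ * ‖d‖ := real_inner_le_norm _ _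
      have h2 : ‖f' (a + t • d) - f' a‖ ≤ t * ‖d‖ := by
        have := hl.norm_sub_le (a + t • d) a
        simpa [norm_smul, abs_of_pos ht.1] using this
      rw [inner_sub_left] at h1
      nlinarith [mul_le_mul_of_nonneg_right h2 (norm_nonneg d)])
  have := hanti (Set.left_mem_Icc.2 zero_le_one) (Set.right_mem_Icc.2 zero_le_one) zero_le_one
  simp at this
  linarith


/-- **Descent lemma for projected proximal step** (Lemma 3.1 of Chambolle–Dossal, adapted):
if `x` minimizes `u ↦ ½‖u - x̄ + ∇f(x̄)‖² + g(u)` over the nonempty closed convex set `U`,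
then for every `z ∈ U`, `E(x) + ½‖x - z‖² ≤ E(z) + ½‖x̄ - z‖²` where `E = f + g`. -/
theorem stmt_0
    {H : Type*} [NormedAddCommGroup H] [InnerProductSpace ℝ H] [CompleteSpace H]
    (f g : H → ℝ) (f' : H → H)
    (hf_conv : ConvexOn ℝ Set.univ f)
    (hg_conv : ConvexOn ℝ Set.univ g)
    (hf' : ∀ u, HasGradientAt f (f' u) u)
    (hf'_lip : LipschitzWith 1 f')
    (E : H → ℝ) (hE : ∀ u, E u = f u + g u)
    (U : Set H) (hU_ne : U.Nonempty) (hU_closed : IsClosed U) (hU_conv : Convex ℝ U)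
    (xbar x : H) (hxU : x ∈ U)
    (hmin : ∀ u ∈ U,
      (1/2) * ‖x - xbar + f' xbar‖^2 + g x ≤ (1/2) * ‖u - xbar + f' xbar‖^2 + g u) :
    ∀ z ∈ U, E x + (1/2) * ‖x - z‖^2 ≤ E z + (1/2) * ‖xbar - z‖^2 := by

  intro z hz
  have hg : g x ≤ g z + ⟪x - xbar + f' xbar, z - x⟫ := by
    have key : ∀ t : ℝ, 0 < t → t < 1 →
        g x ≤ g z + ⟪x - xbar + f' xbar, z - x⟫ + t * ((1/2) * ‖z - x‖^2) := by
      intro t h0 h1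
      have hu := hmin _ (hU_conv hxU hz (sub_nonneg.2 h1.le) h0.le (by ring))
      have hgc := hg_conv.2 (Set.mem_univ x) (Set.mem_univ z) (sub_nonneg.2 h1.le) h0.le (by ring)
      have e : (1 - t) • x + t • z - xbar + f' xbar = (x - xbar + f' xbar) + t • (z - x) := by
        module
      rw [e, norm_add_sq_real _ (t • (z - x)), inner_smul_right, norm_smul, mul_pow, Real.norm_eq_abs, sq_abs] at hu
      simp only [smul_eq_mul] at hgc
      have : t * g x ≤ t * (g z + ⟪x - xbar + f' xbar, z - x⟫ + t * ((1/2) * ‖z - x‖^2)) := by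
        linarith
      exact le_of_mul_le_mul_left this h0
    have hlim : Filter.Tendsto (fun t : ℝ => g z + ⟪x - xbar + f' xbar, z - x⟫
        + t * ((1/2) * ‖z - x‖^2)) (nhdsWithin 0 (Set.Ioi 0))
        (nhds (g z + ⟪x - xbar + f' xbar, z - x⟫ + 0 * ((1/2) * ‖z - x‖^2))) := by
      apply Filter.Tendsto.mono_left _ nhdsWithin_le_nhds
      exact Continuous.tendsto (by fun_prop) 0
    have := ge_of_tendsto hlim (b := g x) (by
      filter_upwards [Ioo_mem_nhdsGT (zero_lt_one (α := ℝ))] with t ht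
      exact key t ht.1 ht.2)
    linarith
  have hup := aux_upper f f' hf' hf'_lip xbar (x - xbar)
  have hlo := aux_lower f f' hf' hf_conv xbar (z - xbar)
  rw [add_sub_cancel] at hup hlo
  rw [hE, hE]
  have e1 : ⟪f' xbar, z - x⟫ = ⟪f' xbar, z - xbar⟫ - ⟪f' xbar, x - xbar⟫ := by
    rw [← inner_sub_right]; congr 1; abel
  have e2 : ‖xbar - z‖^2 = ‖x - xbar‖^2 + 2 * ⟪x - xbar, z - x⟫ + ‖x - z‖^2 := by
    rw [norm_sub_rev x z, ← norm_add_sq_real, norm_sub_rev xbar z]; congr 2; abel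
  rw [inner_add_left] at hg
  linarith
end

section
/- In the refining-subset FISTA setup, let 0 = n_0 < n_1 < n_2 < … be integers and for each k ≥ 0 let z̃_k be a point belonging to U^n for every n with n_k ≤ n < n_{k+1}. Suppose there are constants a_U > 1, a_E ≥ 1, C_U > 0, C_E > 0, C_n > 0 such that ‖z̃_k‖ ≤ C_U·a_U^k, E_0(z̃_k) ≤ C_E·a_E^{−k}, and n_k² ≤ C_n·a_E^k·a_U^{2k} for all k ≥ 0. Then there exists C' > 0 such that for every K ≥ 0 and every integer N ≥ 1 with n_K ≤ N < n_{K+1}, t_N²·E_0(x_N) ≤ C'·a_U^{2K}; consequently, if in addition t_n ≥ τ·n for all n ≥ 1 and some τ > 0, then E_0(x_N) ≤ (C'/τ²)·a_U^{2K}·N^{−2} for all such N. -/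
open scoped RealInnerProductSpace


theorem aux_line {H : Type*} [NormedAddCommGroup H] [InnerProductSpace ℝ H] [CompleteSpace H]
    (f : H → ℝ) (f' : H → H) (hf' : ∀ u, HasGradientAt f (f' u) u) (u d : H) (s : ℝ) :
    HasDerivAt (fun s : ℝ => f (u + s • d)) (inner ℝ (f' (u + s • d)) d) s := by
  have h1 : HasDerivAt (fun s : ℝ => u + s • d) d s := by
    simpa using ((hasDerivAt_id s).smul_const d).const_add u
  have h2 := (hf' (u + s • d)).hasFDerivAt.comp_hasDerivAt s h1
  simp at h2
  exact h2

theorem aux_descent {H : Type*} [NormedAddCommGroup H] [InnerProductSpace ℝ H] [CompleteSpace H]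
    (f : H → ℝ) (f' : H → H) (hf' : ∀ u, HasGradientAt f (f' u) u)
    (hl : LipschitzWith 1 f') (u v : H) :
    f v ≤ f u + inner ℝ (f' u) (v - u) + 1/2 * ‖v - u‖ ^ 2 := by
  set d := v - u with hd
  let h : ℝ → ℝ := fun s => f (u + s • d) - s * inner ℝ (f' u) d - s ^ 2 / 2 * ‖d‖ ^ 2
  have hder : ∀ s, HasDerivAt h (inner ℝ (f' (u + s • d)) d - inner ℝ (f' u) d - s * ‖d‖ ^ 2) s := by
    intro s
    have e1 := (hasDerivAt_id s).mul_const (inner ℝ (f' u) d)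
    have e2 := ((hasDerivAt_pow 2 s).div_const 2).mul_const (‖d‖ ^ 2)
    have e3 := ((aux_line f f' hf' u d s).sub e1).sub e2
    refine e3.congr_deriv ?_
    push_cast
    ring
  have hanti : AntitoneOn h (Set.Icc 0 1) := by
    apply antitoneOn_of_deriv_nonpos (convex_Icc 0 1)
    · exact fun s _ => (hder s).continuousAt.continuousWithinAt
    · exact fun s _ => (hder s).differentiableAt.differentiableWithinAt
    · intro s hs
      rw [interior_Icc] at hs
      rw [(hder s).deriv, ← inner_sub_left]
      have a1 := real_inner_le_norm (f' (u + s • d) - f' u) d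
      have a2 : ‖f' (u + s • d) - f' u‖ ≤ s * ‖d‖ := by
        have := hl.dist_le_mul (u + s • d) u
        simpa [dist_eq_norm, norm_smul, abs_of_pos hs.1] using this
      nlinarith [norm_nonneg d]
  have := hanti (by simp) (by simp) (zero_le_one' ℝ)
  simp only [h] at this
  have e : u + (1:ℝ) • d = v := by simp [hd]
  rw [e] at this
  simp at this
  linarith

theorem aux_grad {H : Type*} [NormedAddCommGroup H] [InnerProductSpace ℝ H] [CompleteSpace H]
    (f : H → ℝ) (f' : H → H) (hc : ConvexOn ℝ Set.univ f)
    (hf' : ∀ u, HasGradientAt f (f' u) u) (u v : H) :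
    f u + inner ℝ (f' u) (v - u) ≤ f v := by
  have hc' : ConvexOn ℝ Set.univ (fun s : ℝ => f (u + s • (v - u))) := by
    refine ⟨convex_univ, fun a _ b _ p q hp hq hpq => ?_⟩
    have := hc.2 (Set.mem_univ (u + a • (v - u))) (Set.mem_univ (u + b • (v - u))) hp hq hpq
    have e : p • (u + a • (v - u)) + q • (u + b • (v - u)) = u + (p • a + q • b) • (v - u) := by
      have : q = 1 - p := by linarith
      subst this
      simp only [smul_eq_mul]
      module
    rw [e] at this
    exact this
  have := hc'.le_slope_of_hasDerivAt (x := 0) (y := 1) (by simp) (by simp) one_pos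
    (aux_line f f' hf' u (v - u) 0)
  simp [slope_def_field] at this
  linarith

theorem aux_prox {H : Type*} [NormedAddCommGroup H] [InnerProductSpace ℝ H]
    (g : H → ℝ) (hg : ConvexOn ℝ Set.univ g) (U : Set H) (hU : Convex ℝ U) (w p : H)
    (hp : p ∈ U) (hmin : ∀ u ∈ U, (1/2) * ‖p - w‖ ^ 2 + g p ≤ (1/2) * ‖u - w‖ ^ 2 + g u)
    (u : H) (hu : u ∈ U) :
    (1/2) * ‖p - w‖ ^ 2 + g p + (1/2) * ‖u - p‖ ^ 2 ≤ (1/2) * ‖u - w‖ ^ 2 + g u := by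
  have key : ∀ s : ℝ, 0 < s → s < 1 →
      (1/2) * ‖p - w‖ ^ 2 + g p + (1/2) * (1 - s) * ‖u - p‖ ^ 2 ≤ (1/2) * ‖u - w‖ ^ 2 + g u := by
    intro s h0 h1
    have a1 := hmin _ (hU hp hu (by linarith : 0 ≤ 1 - s) h0.le (by ring))
    have a2 := hg.2 (Set.mem_univ p) (Set.mem_univ u) (by linarith : 0 ≤ 1 - s) h0.le (by ring)
    have a3 : ‖(1 - s) • p + s • u - w‖ ^ 2 =
        (1 - s) * ‖p - w‖ ^ 2 + s * ‖u - w‖ ^ 2 - s * (1 - s) * ‖u - p‖ ^ 2 := by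
      have e1 : (1 - s) • p + s • u - w = (p - w) + s • ((u - w) - (p - w)) := by module
      have e2 : u - p = (u - w) - (p - w) := by abel
      rw [e1, e2]
      generalize p - w = a
      generalize u - w = b
      simp only [← real_inner_self_eq_norm_sq, inner_add_left, inner_add_right, inner_sub_left,
        inner_sub_right, real_inner_smul_left, real_inner_smul_right, real_inner_comm a b]
      ring
    rw [a3] at a1
    simp only [smul_eq_mul] at a2
    have : s * ((1/2) * ‖p - w‖ ^ 2 + g p + (1/2) * (1 - s) * ‖u - p‖ ^ 2) ≤
      s * ((1/2) * ‖u - w‖ ^ 2 + g u) := by nlinarith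
    exact le_of_mul_le_mul_left this h0
  by_contra hcon
  push Not at hcon
  set δ := (1/2) * ‖p - w‖ ^ 2 + g p + (1/2) * ‖u - p‖ ^ 2 - ((1/2) * ‖u - w‖ ^ 2 + g u) with hδ
  have hδ0 : 0 < δ := by linarith
  have hn := sq_nonneg ‖u - p‖
  set n := ‖u - p‖ ^ 2
  have := key (δ / (δ + n + 1)) (by positivity) (by rw [div_lt_one (by positivity)]; linarith)
  have h2 : δ / (δ + n + 1) * n < δ := by
    rw [div_mul_eq_mul_div, div_lt_iff₀ (by positivity)]
    nlinarith
  nlinarith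

theorem aux_step {H : Type*} [NormedAddCommGroup H] [InnerProductSpace ℝ H] [CompleteSpace H]
    (f g : H → ℝ) (f' : H → H)
    (hf : ConvexOn ℝ Set.univ f) (hg : ConvexOn ℝ Set.univ g)
    (hf' : ∀ u, HasGradientAt f (f' u) u) (hl : LipschitzWith 1 f') (U : Set H)
    (hU : Convex ℝ U) (x x1 y y1 xb z : H) (t m : ℝ) (ht : 1 ≤ t)
    (hxb : xb = (1 - 1 / t) • x + (1 / t) • y) (hx1 : x1 ∈ U)
    (hmin : ∀ u ∈ U, (1/2) * ‖x1 - xb + f' xb‖ ^ 2 + g x1 ≤ (1/2) * ‖u - xb + f' xb‖ ^ 2 + g u)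
    (hy : y1 = (1 - t) • x + t • x1) (hx : x ∈ U) (hz : z ∈ U) :
    2 * (t ^ 2 * (f x1 + g x1 - m)) + ‖y1 - z‖ ^ 2 ≤
      2 * ((t ^ 2 - t) * (f x + g x - m)) + 2 * (t * (f z + g z - m)) + ‖y - z‖ ^ 2 := by
  have ht0 : 0 < t := by linarith
  have hti : 1 / t ≤ 1 := by rw [div_le_one ht0]; exact ht
  have hti0 : 0 ≤ 1 / t := by positivity
  have htt : t * (1 / t) = 1 := by field_simp
  set r := 1 / t with hr
  obtain ⟨u, hu⟩ : ∃ u, u = (1 - r) • x + r • z := ⟨_, rfl⟩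
  have huU : u ∈ U := by rw [hu]; exact hU hx hz (by linarith) hti0 (by ring)
  have b1 := aux_prox g hg U hU (xb - f' xb) x1 hx1 (by
    intro v hv
    have := hmin v hv
    rwa [← sub_add, ← sub_add]) u huU
  rw [← sub_add, ← sub_add] at b1
  have b2 := aux_descent f f' hf' hl xb x1
  have b3 := aux_grad f f' hf hf' xb u
  have b4 := hf.2 (Set.mem_univ x) (Set.mem_univ z) (by linarith : 0 ≤ 1 - r) hti0 (by ring)
  have b5 := hg.2 (Set.mem_univ x) (Set.mem_univ z) (by linarith : 0 ≤ 1 - r) hti0 (by ring)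
  rw [← hu] at b4 b5
  simp only [smul_eq_mul] at b4 b5
  rw [norm_add_sq_real, norm_add_sq_real, real_inner_comm, real_inner_comm (f' xb) (u - xb)] at b1
  have c1 : y1 - z = (-t) • (u - x1) := by
    rw [hy, hu]
    have : t • r • z = z := by rw [smul_smul, htt, one_smul]
    have h2 : t • r • x = x := by rw [smul_smul, htt, one_smul]
    have e : (-t) • ((1 - r) • x + r • z - x1) = t • x1 - t • x + t • r • x - t • r • z := by module
    rw [e, this, h2]; module
  have c2 : y - z = (-t) • (u - xb) := by
    rw [hxb, hu]
    have : t • r • z = z := by rw [smul_smul, htt, one_smul]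
    have h2 : t • r • y = y := by rw [smul_smul, htt, one_smul]
    have e : (-t) • ((1 - r) • x + r • z - ((1 - r) • x + r • y)) = t • r • y - t • r • z := by module
    rw [e, this, h2]
  rw [c1, c2, norm_smul, norm_smul, mul_pow, mul_pow]
  simp only [norm_neg, Real.norm_eq_abs, sq_abs]
  have d : (f x1 + g x1) + 1/2 * ‖u - x1‖ ^ 2 ≤
      (1 - r) * (f x + g x) + r * (f z + g z) + 1/2 * ‖u - xb‖ ^ 2 := by
    nlinarith
  have d2 := mul_le_mul_of_nonneg_left d (by positivity : 0 ≤ 2 * t ^ 2)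
  have e : 2 * t ^ 2 * ((1 - r) * (f x + g x) + r * (f z + g z) + 1/2 * ‖u - xb‖ ^ 2) =
     2 * (t ^ 2 - t * (t * r)) * (f x + g x) + 2 * t * (t * r) * (f z + g z) + t ^ 2 * ‖u - xb‖ ^ 2 := by
    ring
  rw [e, htt] at d2
  nlinarith

theorem aux_main {H : Type*} [NormedAddCommGroup H] [InnerProductSpace ℝ H]
    (A t e : ℕ → ℝ) (y zt : ℕ → H) (hA0 : A 0 = 0) (hA : ∀ n, 0 ≤ A n)
    (ht : ∀ n : ℕ, t n ≤ n + 1) (he : ∀ k, 0 ≤ e k)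
    (nk : ℕ → ℕ) (hnk0 : nk 0 = 0) (hnk_mono : StrictMono nk)
    (hstep : ∀ k n : ℕ, nk k ≤ n + 1 → n + 1 < nk (k + 1) →
      2 * A (n + 1) + ‖y (n + 1) - zt k‖ ^ 2 ≤ 2 * A n + 2 * (t n * e k) + ‖y n - zt k‖ ^ 2)
    (aU aE CU CE Cn : ℝ)
    (haU : 1 < aU) (haE : 1 ≤ aE) (hCU : 0 < CU) (hCE : 0 < CE) (hCn : 0 < Cn)
    (hzt_norm : ∀ k : ℕ, ‖zt k‖ ≤ CU * aU ^ k)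
    (hzt_E : ∀ k : ℕ, e k ≤ CE * (aE ^ k)⁻¹)
    (hnk_bound : ∀ k : ℕ, ((nk k : ℝ)) ^ 2 ≤ Cn * aE ^ k * aU ^ (2 * k)) :
    ∃ C > 0, ∀ K N : ℕ, nk K ≤ N → N < nk (K + 1) → A N ≤ C * aU ^ (2 * K) := by
  obtain ⟨D, hD⟩ : ∃ D, D = 2 * (Cn * CE * aE * aU ^ 2) := ⟨_, rfl⟩
  have hD0 : 0 < D := by rw [hD]; positivity
  -- inside a stage
  have hin : ∀ k N, nk k - 1 ≤ N → N < nk (k + 1) →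
      2 * A N + ‖y N - zt k‖ ^ 2 ≤
        2 * A (nk k - 1) + ‖y (nk k - 1) - zt k‖ ^ 2 + D * aU ^ (2 * k) := by
    intro k N h1 h2
    have hind : 2 * A N + ‖y N - zt k‖ ^ 2 ≤
        2 * A (nk k - 1) + ‖y (nk k - 1) - zt k‖ ^ 2 + 2 * (N * nk (k + 1) * e k) := by
      induction N, h1 using Nat.le_induction with
      | base =>
        have := he k
        have : 0 ≤ 2 * (((nk k - 1 : ℕ) : ℝ) * nk (k + 1) * e k) := by positivity
        linarith
      | succ n hn ih =>
        have i1 := ih (by omega)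
        have i2 := hstep k n (by omega) h2
        have i3 : t n ≤ nk (k + 1) := (ht n).trans (by exact_mod_cast h2.le)
        have i4 := mul_le_mul_of_nonneg_right i3 (he k)
        push_cast
        linarith
    have j1 : (N : ℝ) * nk (k + 1) * e k ≤ (nk (k + 1) : ℝ) ^ 2 * e k := by
      apply mul_le_mul_of_nonneg_right _ (he k)
      rw [sq]
      gcongr
    have j2 : (nk (k + 1) : ℝ) ^ 2 * e k ≤
        (Cn * aE ^ (k + 1) * aU ^ (2 * (k + 1))) * (CE * (aE ^ k)⁻¹) :=
      mul_le_mul (hnk_bound _) (hzt_E k) (he k) (by positivity)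
    have j3 : 2 * ((Cn * aE ^ (k + 1) * aU ^ (2 * (k + 1))) * (CE * (aE ^ k)⁻¹)) =
        D * aU ^ (2 * k) := by
      rw [hD]
      have : aE ≠ 0 := by positivity
      field_simp
      ring
    linarith
  obtain ⟨B, hB0, hB⟩ : ∃ B, 0 < B ∧ D ≤ B ^ 2 := ⟨D + 1, by positivity, by nlinarith⟩
  obtain ⟨s, hs1, hs2⟩ : ∃ s, ‖y 0 - zt 0‖ ≤ s ∧ (B + CU * (1 + aU)) / (aU - 1) ≤ s :=
    ⟨_, le_max_left _ _, le_max_right _ _⟩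
  rw [div_le_iff₀ (by linarith)] at hs2
  have hs0 : 0 ≤ s := (norm_nonneg _).trans hs1
  have hstart : ∀ k, 2 * A (nk k - 1) + ‖y (nk k - 1) - zt k‖ ^ 2 ≤ (s * aU ^ k) ^ 2 := by
    intro k
    induction k with
    | zero =>
      simp [hnk0, hA0]
      exact pow_le_pow_left₀ (norm_nonneg _) hs1 2
    | succ k ih =>
      have hlt := hnk_mono (Nat.lt_succ_self k)
      have h1 := hin k (nk (k + 1) - 1) (by simp at hlt; omega) (by simp at hlt; omega)
      set n := nk (k + 1) - 1
      have hp : 0 < aU ^ k := by positivity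
      have h2 : 2 * A n + ‖y n - zt k‖ ^ 2 ≤ ((s + B) * aU ^ k) ^ 2 := by
        have : aU ^ (2 * k) = (aU ^ k) ^ 2 := by rw [mul_comm, pow_mul]
        rw [this] at h1
        have : D * (aU ^ k) ^ 2 ≤ B ^ 2 * (aU ^ k) ^ 2 := by gcongr
        have : 0 ≤ 2 * s * B * (aU ^ k) ^ 2 := by positivity
        nlinarith
      have hd : ‖zt k - zt (k + 1)‖ ≤ CU * (1 + aU) * aU ^ k := by
        have := norm_sub_le (zt k) (zt (k + 1))
        have := hzt_norm k
        have := hzt_norm (k + 1)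
        rw [pow_succ] at this
        linarith
      have h3 : ‖y n - zt (k + 1)‖ ≤ ‖y n - zt k‖ + CU * (1 + aU) * aU ^ k := by
        have := norm_sub_le_norm_sub_add_norm_sub (y n) (zt k) (zt (k + 1))
        linarith
      have h4 : ‖y n - zt k‖ ≤ (s + B) * aU ^ k := by
        apply le_of_sq_le_sq _ (by positivity)
        linarith [hA n]
      have h5 : ‖y n - zt (k + 1)‖ ^ 2 ≤ (‖y n - zt k‖ + CU * (1 + aU) * aU ^ k) ^ 2 :=
        pow_le_pow_left₀ (norm_nonneg _) h3 2
      have h6 : 2 * A n + ‖y n - zt (k + 1)‖ ^ 2 ≤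
          ((s + B) * aU ^ k + CU * (1 + aU) * aU ^ k) ^ 2 := by
        have := mul_le_mul_of_nonneg_right h4 (by positivity : 0 ≤ CU * (1 + aU) * aU ^ k)
        nlinarith
      refine h6.trans (pow_le_pow_left₀ (by positivity) ?_ 2)
      rw [pow_succ]
      nlinarith
  refine ⟨s ^ 2 + D, by positivity, fun K N h1 h2 => ?_⟩
  have h3 := hin K N (by omega) h2
  have h4 := hstart K
  have : aU ^ (2 * K) = (aU ^ K) ^ 2 := by rw [mul_comm, pow_mul]
  rw [this] at h3 ⊢
  nlinarith [hA N, sq_nonneg ‖y N - zt K‖]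

/-- **Refinement without overfitting, case `a_U > 1`** (Lemma `sufficiently fast`):
if `‖z̃_k‖ ≤ C_U a_U^k`, `E₀(z̃_k) ≤ C_E a_E^{−k}` and `n_k² ≤ C_n a_E^k a_U^{2k}`, then there is
`C' > 0` with `t_N² E₀(x_N) ≤ C' a_U^{2K}` for `n_K ≤ N < n_{K+1}`, `N ≥ 1`; consequently, if
`t_n ≥ τ n` for all `n ≥ 1` and some `τ > 0`, also `E₀(x_N) ≤ (C'/τ²) a_U^{2K} / N²`
for all such `N`. -/
theorem stmt_4
    {H : Type*} [NormedAddCommGroup H] [InnerProductSpace ℝ H] [CompleteSpace H]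
    (f g E E0 : H → ℝ) (f' : H → H) (m : ℝ)
    (hf_conv : ConvexOn ℝ Set.univ f)
    (hg_conv : ConvexOn ℝ Set.univ g)
    (hf' : ∀ u, HasGradientAt f (f' u) u)
    (hf'_lip : LipschitzWith 1 f')
    (hE : ∀ u, E u = f u + g u)
    (hE_bdd : BddBelow (Set.range E))
    (hm : m = ⨅ u, E u)
    (hE0 : ∀ u, E0 u = E u - m)
    (t ρ : ℕ → ℝ)
    (ht0 : t 0 = 1) (ht1 : ∀ n, 1 ≤ t n)
    (hρ : ∀ n, ρ n = (t n) ^ 2 - (t (n + 1)) ^ 2 + t (n + 1))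
    (hρ0 : ∀ n, 0 ≤ ρ n)
    (U : ℕ → Set H)
    (hU_ne : ∀ n, (U n).Nonempty)
    (hU_closed : ∀ n, IsClosed (U n))
    (hU_conv : ∀ n, Convex ℝ (U n))
    (x y xbar : ℕ → H)
    (hx0 : x 0 = y 0) (hx0U : x 0 ∈ U 0)
    (hxbar : ∀ n, xbar n = (1 - 1 / t n) • x n + (1 / t n) • y n)
    (hxmem : ∀ n, x (n + 1) ∈ U (n + 1))
    (hxmin : ∀ n, ∀ u ∈ U (n + 1),
      (1/2) * ‖x (n + 1) - xbar n + f' (xbar n)‖ ^ 2 + g (x (n + 1)) ≤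
        (1/2) * ‖u - xbar n + f' (xbar n)‖ ^ 2 + g u)
    (hy : ∀ n, y (n + 1) = (1 - t n) • x n + t n • x (n + 1))
    (hxU : ∀ n, x n ∈ U (n + 1))
    (nk : ℕ → ℕ) (hnk0 : nk 0 = 0) (hnk_mono : StrictMono nk)
    (zt : ℕ → H)
    (hzt : ∀ k n : ℕ, nk k ≤ n → n < nk (k + 1) → zt k ∈ U n)
    (aU aE CU CE Cn : ℝ)
    (haU : 1 < aU) (haE : 1 ≤ aE) (hCU : 0 < CU) (hCE : 0 < CE) (hCn : 0 < Cn)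
    (hzt_norm : ∀ k : ℕ, ‖zt k‖ ≤ CU * aU ^ k)
    (hzt_E : ∀ k : ℕ, E0 (zt k) ≤ CE * (aE ^ k)⁻¹)
    (hnk_bound : ∀ k : ℕ, ((nk k : ℝ)) ^ 2 ≤ Cn * aE ^ k * aU ^ (2 * k)) :
    ∃ C' > 0,
      (∀ K N : ℕ, 1 ≤ N → nk K ≤ N → N < nk (K + 1) →
        (t N) ^ 2 * E0 (x N) ≤ C' * aU ^ (2 * K)) ∧
      (∀ τ : ℝ, 0 < τ → (∀ n : ℕ, 1 ≤ n → τ * n ≤ t n) →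
        ∀ K N : ℕ, 1 ≤ N → nk K ≤ N → N < nk (K + 1) →
          E0 (x N) ≤ (C' / τ ^ 2) * aU ^ (2 * K) / (N : ℝ) ^ 2) := by
  have hm_le : ∀ u, m ≤ E u := fun u => hm ▸ ciInf_le hE_bdd u
  have hE0n : ∀ u, 0 ≤ E0 u := fun u => by rw [hE0]; linarith [hm_le u]
  have htrec : ∀ n, t (n + 1) ^ 2 - t (n + 1) ≤ t n ^ 2 := fun n => by
    have := hρ0 n
    rw [hρ] at this
    linarith
  have htinc : ∀ n, t (n + 1) ≤ t n + 1 := fun n => by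
    have := htrec n
    have := ht1 n
    have := ht1 (n + 1)
    by_contra hc
    push Not at hc
    nlinarith
  have htn : ∀ n : ℕ, t n ≤ n + 1 := by
    intro n
    induction n with
    | zero => simp [ht0]
    | succ n ih => push_cast; linarith [htinc n]
  let A : ℕ → ℝ := fun n => Nat.casesOn n 0 (fun j => t j ^ 2 * E0 (x (j + 1)))
  have hA : ∀ n, 0 ≤ A n := by
    intro n
    cases n with
    | zero => exact le_rfl
    | succ j => exact mul_nonneg (sq_nonneg _) (hE0n _)
  have hA2 : ∀ n, (t n ^ 2 - t n) * E0 (x n) ≤ A n := by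
    intro n
    cases n with
    | zero => simp [A, ht0]
    | succ j => exact mul_le_mul_of_nonneg_right (htrec j) (hE0n _)
  obtain ⟨C, hC, hmain⟩ := aux_main A t (fun k => E0 (zt k)) y zt rfl hA htn (fun k => hE0n _) nk
    hnk0 hnk_mono (by
      intro k n h1 h2
      have := aux_step f g f' hf_conv hg_conv hf' hf'_lip (U (n + 1)) (hU_conv _) (x n) (x (n + 1))
        (y n) (y (n + 1)) (xbar n) (zt k) (t n) m (ht1 n) (hxbar n) (hxmem n) (hxmin n) (hy n)
        (hxU n) (hzt k (n + 1) h1 h2)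
      rw [← hE, ← hE, ← hE, ← hE0, ← hE0, ← hE0] at this
      have h3 := hA2 n
      have h4 : A (n + 1) = t n ^ 2 * E0 (x (n + 1)) := rfl
      rw [h4]
      linarith) aU aE CU CE Cn haU haE hCU hCE hCn hzt_norm hzt_E hnk_bound
  have hfirst : ∀ K N : ℕ, 1 ≤ N → nk K ≤ N → N < nk (K + 1) →
        (t N) ^ 2 * E0 (x N) ≤ (4 * C) * aU ^ (2 * K) := by
    intro K N hN h1 h2
    have h3 := hmain K N h1 h2
    obtain ⟨j, rfl⟩ : ∃ j, N = j + 1 := ⟨N - 1, by omega⟩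
    have h4 : A (j + 1) = t j ^ 2 * E0 (x (j + 1)) := rfl
    rw [h4] at h3
    have h5 : t (j + 1) ^ 2 ≤ 4 * t j ^ 2 := by
      have := htinc j
      have := ht1 j
      have := ht1 (j + 1)
      nlinarith
    have := mul_le_mul_of_nonneg_right h5 (hE0n (x (j + 1)))
    linarith
  refine ⟨4 * C, by positivity, hfirst, ?_⟩
  intro τ hτ hτt K N hN h1 h2
  have h3 := hfirst K N hN h1 h2
  have h4 := hτt N hN
  have hNp : (0:ℝ) < N := by exact_mod_cast hN
  have h5 : (τ * N) ^ 2 ≤ t N ^ 2 := pow_le_pow_left₀ (by positivity) h4 2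
  have h6 := mul_le_mul_of_nonneg_right h5 (hE0n (x N))
  rw [le_div_iff₀ (by positivity), div_mul_eq_mul_div, le_div_iff₀ (by positivity)]
  nlinarith
end

section
/- Let Ω = [0,1]^d, let ψ_1, …, ψ_m : Ω → ℝ be continuously differentiable, and define A from finite signed Borel measures on Ω to ℝ^m by (Aμ)_j = ∫_Ω ψ_j dμ. Let f : ℝ^m → ℝ be convex and differentiable with 1-Lipschitz gradient, b ∈ ℝ^m, λ ≥ 0, and define E(μ) := f(Aμ − b) + λ·|μ|(Ω). Let μ* be a finite signed Borel measure on Ω, let M be a finite Borel partition of Ω into sets of positive Lebesgue measure each of diameter at most h, and let ν be the measure with Lebesgue density Σ_{ω∈M} (μ*(ω)/|ω|)·1_ω. Then: (i) |ν|(Ω) ≤ |μ*|(Ω); (ii) ‖Aν − Aμ*‖_{ℓ²} ≤ h·S·|μ*|(Ω), where S := sup over r ∈ ℝ^m with ‖r‖_{ℓ²} ≤ 1 of the supremum norm of the gradient of x ↦ Σ_{j=1}^m r_j ψ_j(x) on Ω; and (iii) E(ν) − E(μ*) ≤ (‖∇f(Aμ*−b)‖_{ℓ²} + h·S·|μ*|(Ω))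 · h·S·|μ*|(Ω). -/
open MeasureTheory

/-- For a signed measure `s`, the integral `∫ f ds` defined via the Jordan decomposition. -/
noncomputable def signedIntegral {α : Type*} [MeasurableSpace α]
    (s : SignedMeasure α) (f : α → ℝ) : ℝ :=
  (∫ x, f x ∂s.toJordanDecomposition.posPart) - ∫ x, f x ∂s.toJordanDecomposition.negPart

theorem aux_cell {α : Type*} [MeasurableSpace α] (Q : Measure α) (ω : Set α)
    (hω : MeasurableSet ω) (hQ : Q ω ≠ ⊤) (φ : α → ℝ) (hφ : IntegrableOn φ ω Q) (a L : ℝ)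
    (hb : ∀ z ∈ ω, |φ z - a| ≤ L) :
    |(∫ x in ω, φ x ∂Q) - a * Q.real ω| ≤ L * Q.real ω := by
  have h1 : (∫ x in ω, φ x ∂Q) - a * Q.real ω = ∫ x in ω, (φ x - a) ∂Q := by
    rw [integral_sub hφ (integrableOn_const hQ)]
    simp [mul_comm]
  rw [h1]
  have := norm_setIntegral_le_of_norm_le_const (μ := Q) (s := ω) (f := fun x => φ x - a) (C := L)
    (lt_top_iff_ne_top.2 hQ) (by simpa using hb)
  simpa using this

theorem aux_restrict {α : Type*} [MeasurableSpace α] (Q : Measure α) (ω : Set α)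
    (hω : MeasurableSet ω) (g : α → ENNReal) (c : ENNReal)
    (hg : ∀ z ∈ ω, g z = c) : (Q.withDensity g).restrict ω = c • Q.restrict ω := by
  rw [restrict_withDensity hω, ← withDensity_const]
  apply withDensity_congr_ae
  filter_upwards [ae_restrict_mem hω] with z hz using hg z hz

theorem aux_jordan {α : Type*} [MeasurableSpace α] (Q : Measure α) (ρ : α → ℝ)
    (hm : Measurable ρ) (hi : Integrable ρ Q) (ν : SignedMeasure α) (hν : ν = Q.withDensityᵥ ρ) :
    ν.toJordanDecomposition.posPart = Q.withDensity (fun x => ENNReal.ofReal (ρ x))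
    ∧ ν.toJordanDecomposition.negPart
      = Q.withDensity (fun x => ENNReal.ofReal (- ρ x)) := by
  have := SignedMeasure.toJordanDecomposition_eq_of_eq_add_withDensity (μ := Q) (t := 0)
    (s := ν) hm hi VectorMeasure.MutuallySingular.zero_left (by simp [hν])
  rw [this]
  simp [SignedMeasure.toJordanDecomposition_zero]

theorem aux_sum {α : Type*} [MeasurableSpace α] (Q : Measure α) (Ω : Set α)
    (M : Finset (Set α)) (hM_meas : ∀ ω ∈ M, MeasurableSet ω)
    (hM_disj : ∀ ω ∈ M, ∀ ω' ∈ M, ω ≠ ω' → Disjoint ω ω')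
    (hM_cover : ⋃ ω ∈ M, ω = Ω) (hQ : Q Ωᶜ = 0) (φ : α → ℝ) (hφ : Integrable φ Q) :
    ∫ x, φ x ∂Q = ∑ ω ∈ M, ∫ x in ω, φ x ∂Q := by
  have := integral_biUnion_finset (μ := Q) (f := φ) M (s := fun ω => ω) hM_meas
    (fun a ha b hb hab => hM_disj a ha b hb hab) (fun i _ => hφ.integrableOn)
  rw [← this, hM_cover, ← setIntegral_univ]
  apply setIntegral_congr_set
  rw [← ae_eq_univ] at hQ
  exact hQ.symm

theorem aux_real {α : Type*} [MeasurableSpace α] (Q : Measure α) [IsFiniteMeasure Q] (Ω : Set α)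
    (M : Finset (Set α)) (hM_meas : ∀ ω ∈ M, MeasurableSet ω)
    (hM_disj : ∀ ω ∈ M, ∀ ω' ∈ M, ω ≠ ω' → Disjoint ω ω')
    (hM_cover : ⋃ ω ∈ M, ω = Ω) :
    Q.real Ω = ∑ ω ∈ M, Q.real ω := by
  rw [← hM_cover]
  exact measureReal_biUnion_finset (fun a ha b hb hab => hM_disj a ha b hb hab) hM_meas

theorem aux_int {α : Type*} [MeasurableSpace α] [TopologicalSpace α] [OpensMeasurableSpace α]
    (Q : Measure α) [IsFiniteMeasure Q] (Ω : Set α)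
    (hΩ : IsCompact Ω) (hQ : Q Ωᶜ = 0) (φ : α → ℝ) (hφ : Continuous φ) : Integrable φ Q := by
  obtain ⟨C, hC⟩ := hΩ.exists_bound_of_continuousOn hφ.continuousOn
  refine Integrable.of_bound hφ.measurable.aestronglyMeasurable C ?_
  rw [ae_iff]
  refine measure_mono_null ?_ hQ
  intro x hx hx'
  exact hx (hC x hx')

theorem aux_tv {α : Type*} [MeasurableSpace α] (s : SignedMeasure α) (ω : Set α) :
    (s.totalVariation ω).toReal = s.toJordanDecomposition.posPart.real ω +
      s.toJordanDecomposition.negPart.real ω := by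
  rw [SignedMeasure.totalVariation, ← measureReal_def, measureReal_add_apply]

theorem aux_main_s9 {α : Type*} [MeasurableSpace α] [TopologicalSpace α] [OpensMeasurableSpace α]
    (vol : Measure α) [IsFiniteMeasureOnCompacts vol] (Ω : Set α) (hΩ : IsCompact Ω)
    (hΩm : MeasurableSet Ω)
    (μ : SignedMeasure α) (hμΩ : μ.totalVariation Ωᶜ = 0)
    (M : Finset (Set α)) (hM_meas : ∀ ω ∈ M, MeasurableSet ω)
    (hM_pos : ∀ ω ∈ M, 0 < vol ω)
    (hM_disj : ∀ ω ∈ M, ∀ ω' ∈ M, ω ≠ ω' → Disjoint ω ω')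
    (hM_cover : ⋃ ω ∈ M, ω = Ω) (ρ : α → ℝ)
    (hρ : ∀ z, ρ z = ∑ ω ∈ M, (μ ω / (vol ω).toReal) * Set.indicator ω 1 z)
    (ν : SignedMeasure α) (hν : ν = vol.withDensityᵥ ρ) :
    ν.totalVariation Ωᶜ = 0 ∧
    (ν.totalVariation Ω).toReal ≤ (μ.totalVariation Ω).toReal ∧
    ∀ φ : α → ℝ, Continuous φ → ∀ L : ℝ, (∀ ω ∈ M, ∀ x ∈ ω, ∀ y ∈ ω, |φ x - φ y| ≤ L) →
      |signedIntegral ν φ - signedIntegral μ φ|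
        ≤ L * (μ.totalVariation Ω).toReal := by
  have hsub : ∀ ω ∈ M, ω ⊆ Ω := fun ω hω => hM_cover ▸ Set.subset_biUnion_of_mem (u := id) hω
  have hfin : ∀ ω ∈ M, vol ω ≠ ⊤ := fun ω hω =>
    ((measure_mono (hsub ω hω)).trans_lt hΩ.measure_lt_top).ne
  have hVpos : ∀ ω ∈ M, 0 < vol.real ω := fun ω hω =>
    ENNReal.toReal_pos (hM_pos ω hω).ne' (hfin ω hω)
  have hρe : ρ = fun z => ∑ ω ∈ M, (μ ω / (vol ω).toReal) * Set.indicator ω 1 z := funext hρ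
  have hm : Measurable ρ := by
    rw [hρe]
    refine Finset.measurable_sum _ fun ω hω => ?_
    exact (measurable_one.indicator (hM_meas ω hω)).const_mul _
  have hi : Integrable ρ vol := by
    rw [hρe]
    refine integrable_finsetSum _ fun ω hω => ?_
    refine Integrable.const_mul ?_ _
    rw [integrable_indicator_iff (hM_meas ω hω)]
    exact integrableOn_const (hfin ω hω)
  have hρω : ∀ ω ∈ M, ∀ z ∈ ω, ρ z = μ ω / vol.real ω := by
    intro ω hω z hz
    rw [hρ, Finset.sum_eq_single ω]
    · simp [hz, measureReal_def]
    · intro ω' hω' hne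
      have : z ∉ ω' := fun h => (Set.disjoint_left.1 (hM_disj ω' hω' ω hω hne)) h hz
      simp [this]
    · exact fun h => absurd hω h
  have hρ0 : ∀ z ∈ Ωᶜ, ρ z = 0 := by
    intro z hz
    rw [hρ]
    refine Finset.sum_eq_zero fun ω hω => ?_
    have : z ∉ ω := fun h => hz (hsub ω hω h)
    simp [this]
  obtain ⟨hp, hn⟩ := aux_jordan vol ρ hm hi ν hν
  have fp : IsFiniteMeasure ν.toJordanDecomposition.posPart := inferInstance
  have fn : IsFiniteMeasure ν.toJordanDecomposition.negPart := inferInstance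
  set P' := ν.toJordanDecomposition.posPart with hP'
  set N' := ν.toJordanDecomposition.negPart with hN'
  set P := μ.toJordanDecomposition.posPart with hP
  set N := μ.toJordanDecomposition.negPart with hN
  have hPr : ∀ ω ∈ M, P'.restrict ω = ENNReal.ofReal (μ ω / vol.real ω) • vol.restrict ω := by
    intro ω hω
    rw [hp]
    exact aux_restrict _ _ (hM_meas ω hω) _ _ (fun z hz => by rw [hρω ω hω z hz])
  have hNr : ∀ ω ∈ M, N'.restrict ω = ENNReal.ofReal (-(μ ω / vol.real ω)) • vol.restrict ω := by
    intro ω hω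
    rw [hn]
    exact aux_restrict _ _ (hM_meas ω hω) _ _ (fun z hz => by rw [hρω ω hω z hz])
  have hP'0 : P' Ωᶜ = 0 := by
    rw [← Measure.restrict_eq_zero, hp, aux_restrict vol _ hΩm.compl _ 0
      (fun z hz => by simp [hρ0 z hz])]
    simp
  have hN'0 : N' Ωᶜ = 0 := by
    rw [← Measure.restrict_eq_zero, hn, aux_restrict vol _ hΩm.compl _ 0
      (fun z hz => by simp [hρ0 z hz])]
    simp
  have hPN0 : P Ωᶜ = 0 ∧ N Ωᶜ = 0 := by
    simpa [SignedMeasure.totalVariation, ← hP, ← hN] using hμΩ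
  have hμω : ∀ ω ∈ M, μ ω = P.real ω - N.real ω := fun ω hω =>
    SignedMeasure.apply_eq_posPart_real_sub_negPart_real μ (hM_meas ω hω)
  have hmax : ∀ c : ℝ, (ENNReal.ofReal c).toReal - (ENNReal.ofReal (-c)).toReal = c := by
    intro c
    rcases le_total 0 c with h | h
    · simp [ENNReal.toReal_ofReal h, ENNReal.ofReal_of_nonpos (neg_nonpos.2 h)]
    · simp [ENNReal.toReal_ofReal (neg_nonneg.2 h), ENNReal.ofReal_of_nonpos h]
  have hmax' : ∀ c : ℝ, (ENNReal.ofReal c).toReal + (ENNReal.ofReal (-c)).toReal = |c| := by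
    intro c
    rcases le_total 0 c with h | h
    · simp [ENNReal.toReal_ofReal h, ENNReal.ofReal_of_nonpos (neg_nonpos.2 h), abs_of_nonneg h]
    · simp [ENNReal.toReal_ofReal (neg_nonneg.2 h), ENNReal.ofReal_of_nonpos h, abs_of_nonpos h]
  have hsumμ : (μ.totalVariation Ω).toReal = ∑ ω ∈ M, (P.real ω + N.real ω) := by
    rw [aux_tv, aux_real _ Ω M hM_meas hM_disj hM_cover, aux_real _ Ω M hM_meas hM_disj hM_cover,
      ← Finset.sum_add_distrib]
  refine ⟨?_, ?_, ?_⟩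
  · simp [SignedMeasure.totalVariation, ← hP', ← hN', hP'0, hN'0]
  · rw [hsumμ, aux_tv, aux_real _ Ω M hM_meas hM_disj hM_cover,
      aux_real _ Ω M hM_meas hM_disj hM_cover, ← Finset.sum_add_distrib]
    refine Finset.sum_le_sum fun ω hω => ?_
    have e1 : P'.real ω = (ENNReal.ofReal (μ ω / vol.real ω)).toReal * vol.real ω := by
      rw [← measureReal_restrict_apply_self, hPr ω hω]; simp
    have e2 : N'.real ω = (ENNReal.ofReal (-(μ ω / vol.real ω))).toReal * vol.real ω := by
      rw [← measureReal_restrict_apply_self, hNr ω hω]; simp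
    change P'.real ω + N'.real ω ≤ _
    rw [e1, e2, ← add_mul, hmax', abs_div, abs_of_pos (hVpos ω hω),
      div_mul_cancel₀ _ (hVpos ω hω).ne', hμω ω hω]
    have h1 : 0 ≤ P.real ω := measureReal_nonneg
    have h2 : 0 ≤ N.real ω := measureReal_nonneg
    rw [abs_le]; constructor <;> linarith
  · intro φ hφ L hL
    have iP := aux_int P Ω hΩ hPN0.1 φ hφ
    have iN := aux_int N Ω hΩ hPN0.2 φ hφ
    have iP' := aux_int P' Ω hΩ hP'0 φ hφ
    have iN' := aux_int N' Ω hΩ hN'0 φ hφ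
    unfold signedIntegral
    rw [← hP, ← hN, ← hP', ← hN', aux_sum P Ω M hM_meas hM_disj hM_cover hPN0.1 φ iP,
      aux_sum N Ω M hM_meas hM_disj hM_cover hPN0.2 φ iN,
      aux_sum P' Ω M hM_meas hM_disj hM_cover hP'0 φ iP',
      aux_sum N' Ω M hM_meas hM_disj hM_cover hN'0 φ iN', hsumμ, ← Finset.sum_sub_distrib,
      ← Finset.sum_sub_distrib, ← Finset.sum_sub_distrib, Finset.mul_sum]
    refine (Finset.abs_sum_le_sum_abs _ _).trans (Finset.sum_le_sum fun ω hω => ?_)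
    have iv : IntegrableOn φ ω vol :=
      (hφ.continuousOn.integrableOn_compact' hΩ hΩm).mono_set (hsub ω hω)
    have hV := hVpos ω hω
    rw [hPr ω hω, hNr ω hω, integral_smul_measure, integral_smul_measure, ← sub_smul, hmax,
      smul_eq_mul]
    set V := vol.real ω
    set I := ∫ x in ω, φ x ∂vol
    have ha : ∀ z ∈ ω, |φ z - I / V| ≤ L := by
      intro z hz
      have := aux_cell vol ω (hM_meas ω hω) (hfin ω hω) φ iv (φ z) L
        (fun y hy => hL ω hω y hy z hz)
      have e : φ z - I / V = - (I - φ z * V) / V := by field_simp; ring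
      rw [e, abs_div, abs_neg, abs_of_pos hV, div_le_iff₀ hV]
      exact this
    have h1 := aux_cell P ω (hM_meas ω hω) (measure_ne_top _ _) φ iP.integrableOn _ L ha
    have h2 := aux_cell N ω (hM_meas ω hω) (measure_ne_top _ _) φ iN.integrableOn _ L ha
    rw [hμω ω hω]
    have e : (P.real ω - N.real ω) / V * I = I / V * P.real ω - I / V * N.real ω := by ring
    rw [e]
    rw [abs_le] at *
    constructor <;> linarith [h1.1, h1.2, h2.1, h2.2]

theorem aux_f {F : Type*} [NormedAddCommGroup F] [InnerProductSpace ℝ F] [CompleteSpace F]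
    (f : F → ℝ) (f' : F → F) (hf' : ∀ v, HasGradientAt f (f' v) v) (hl : LipschitzWith 1 f')
    (x y : F) (R : ℝ) (hR : ‖y - x‖ ≤ R) : f y - f x ≤ (‖f' x‖ + R) * R := by
  have hR0 : 0 ≤ R := (norm_nonneg _).trans hR
  have := (convex_closedBall x R).norm_image_sub_le_of_norm_hasFDerivWithin_le (𝕜 := ℝ)
    (f := f) (C := ‖f' x‖ + R) (fun z _ => (hf' z).hasFDerivAt.hasFDerivWithinAt)
    (fun z hz => by
      rw [LinearIsometryEquiv.norm_map]
      have h1 := hl.dist_le_mul z x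
      rw [dist_eq_norm] at h1
      have h2 : dist z x ≤ R := hz
      have h3 := norm_le_norm_add_norm_sub (f' x) (f' z)
      have h4 := norm_sub_rev (f' x) (f' z)
      simp only [NNReal.coe_one, one_mul] at h1
      linarith)
    (Metric.mem_closedBall_self hR0) (y := y) (by simpa [dist_eq_norm] using hR)
  refine (le_abs_self _).trans (this.trans ?_)
  gcongr

/-- **Piecewise-constant approximation in the continuous LASSO problem** (Section 5.1):
with `E(μ) = f(Aμ − b) + λ|μ|(Ω)` and `ν` the piecewise-constant averaging of `μ*` on a
partition of `Ω = [0,1]^d` into cells of diameter at most `h`: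
(i) `|ν|(Ω) ≤ |μ*|(Ω)`;
(ii) `‖Aν − Aμ*‖ ≤ h S |μ*|(Ω)`;
(iii) `E(ν) − E(μ*) ≤ (‖∇f(Aμ*−b)‖ + h S |μ*|(Ω)) · h S |μ*|(Ω)`. -/
theorem stmt_9
    (d m : ℕ) (hd : 0 < d) (hm : 0 < m)
    (Ω : Set (EuclideanSpace ℝ (Fin d)))
    (hΩ : Ω = {x : EuclideanSpace ℝ (Fin d) | ∀ i, x i ∈ Set.Icc (0 : ℝ) 1})
    (ψ : Fin m → EuclideanSpace ℝ (Fin d) → ℝ)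
    (hψ : ∀ j, ContDiff ℝ 1 (ψ j))
    (A : SignedMeasure (EuclideanSpace ℝ (Fin d)) → EuclideanSpace ℝ (Fin m))
    (hA : ∀ s (j : Fin m), A s j = signedIntegral s (ψ j))
    (f : EuclideanSpace ℝ (Fin m) → ℝ) (f' : EuclideanSpace ℝ (Fin m) → EuclideanSpace ℝ (Fin m))
    (hf_conv : ConvexOn ℝ Set.univ f)
    (hf' : ∀ v, HasGradientAt f (f' v) v)
    (hf'_lip : LipschitzWith 1 f')
    (b : EuclideanSpace ℝ (Fin m)) (lam : ℝ) (hlam : 0 ≤ lam)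
    (E : SignedMeasure (EuclideanSpace ℝ (Fin d)) → ℝ)
    (hE : ∀ s, E s = f (A s - b) + lam * (s.totalVariation Ω).toReal)
    (μstar : SignedMeasure (EuclideanSpace ℝ (Fin d)))
    (hμΩ : μstar.totalVariation Ωᶜ = 0)
    (M : Finset (Set (EuclideanSpace ℝ (Fin d)))) (h : ℝ) (hh : 0 ≤ h)
    (hM_meas : ∀ ω ∈ M, MeasurableSet ω)
    (hM_pos : ∀ ω ∈ M, 0 < volume ω)
    (hM_diam : ∀ ω ∈ M, Metric.diam ω ≤ h)
    (hM_disj : ∀ ω ∈ M, ∀ ω' ∈ M, ω ≠ ω' → Disjoint ω ω')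
    (hM_cover : ⋃ ω ∈ M, ω = Ω)
    (ρ : EuclideanSpace ℝ (Fin d) → ℝ)
    (hρ : ∀ z, ρ z = ∑ ω ∈ M, (μstar ω / (volume ω).toReal) * Set.indicator ω 1 z)
    (ν : SignedMeasure (EuclideanSpace ℝ (Fin d)))
    (hν : ν = volume.withDensityᵥ ρ)
    (S : ℝ) (hS0 : 0 ≤ S)
    (hS : ∀ r : EuclideanSpace ℝ (Fin m), ‖r‖ ≤ 1 → ∀ z ∈ Ω,
      ‖gradient (fun w => ∑ j, r j * ψ j w) z‖ ≤ S) :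
    (ν.totalVariation Ω).toReal ≤ (μstar.totalVariation Ω).toReal ∧
    ‖A ν - A μstar‖ ≤ h * S * (μstar.totalVariation Ω).toReal ∧
    E ν - E μstar ≤
      (‖f' (A μstar - b)‖ + h * S * (μstar.totalVariation Ω).toReal) *
        (h * S * (μstar.totalVariation Ω).toReal) := by
  have hΩc : IsCompact Ω := by
    have : Ω = (EuclideanSpace.equiv (Fin d) ℝ).toHomeomorph ⁻¹'
        (Set.pi Set.univ fun _ => Set.Icc (0 : ℝ) 1) := by
      rw [hΩ]; ext x
      exact ⟨fun hx i _ => hx i, fun hx i => hx i trivial⟩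
    rw [this, Homeomorph.isCompact_preimage]
    exact isCompact_univ_pi fun _ => isCompact_Icc
  have hΩconv : Convex ℝ Ω := by
    rw [hΩ]
    intro x hx y hy a b ha hb hab i
    exact convex_Icc (0 : ℝ) 1 (hx i) (hy i) ha hb hab
  have hsub : ∀ ω ∈ M, ω ⊆ Ω := fun ω hω => hM_cover ▸ Set.subset_biUnion_of_mem (u := id) hω
  obtain ⟨hν0, hi, hmain⟩ := aux_main_s9 volume Ω hΩc hΩc.measurableSet μstar hμΩ M hM_meas hM_pos
    hM_disj hM_cover ρ hρ ν hν
  have hlin : ∀ s : SignedMeasure (EuclideanSpace ℝ (Fin d)), s.totalVariation Ωᶜ = 0 →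
      ∀ r : EuclideanSpace ℝ (Fin m),
        signedIntegral s (fun w => ∑ j, r j * ψ j w) = ∑ j, r j * A s j := by
    intro s hs r
    have hs' : s.toJordanDecomposition.posPart Ωᶜ = 0 ∧
        s.toJordanDecomposition.negPart Ωᶜ = 0 := by
      simpa [SignedMeasure.totalVariation] using hs
    simp only [hA]
    unfold signedIntegral
    rw [integral_finsetSum _ fun j _ =>
        (aux_int _ Ω hΩc hs'.1 (ψ j) (hψ j).continuous).const_mul (r j),
      integral_finsetSum _ fun j _ =>
        (aux_int _ Ω hΩc hs'.2 (ψ j) (hψ j).continuous).const_mul (r j),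
      ← Finset.sum_sub_distrib]
    simp only [integral_const_mul, mul_sub]
  have hii : ‖A ν - A μstar‖ ≤ h * S * (μstar.totalVariation Ω).toReal := by
    by_cases hv : A ν - A μstar = 0
    · rw [hv, norm_zero]; positivity
    set v := A ν - A μstar with hvd
    have hvn : ‖v‖ ≠ 0 := norm_ne_zero_iff.2 hv
    set r : EuclideanSpace ℝ (Fin m) := (‖v‖)⁻¹ • v with hr
    have hr1 : ‖r‖ ≤ 1 := by
      rw [hr, norm_smul, norm_inv, norm_norm, inv_mul_cancel₀ hvn]
    have hcd : ContDiff ℝ 1 (fun w => ∑ j, r j * ψ j w) :=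
      ContDiff.sum fun j _ => contDiff_const.mul (hψ j)
    have hb := hmain (fun w => ∑ j, r j * ψ j w) hcd.continuous (h * S) (by
      intro ω hω x hx y hy
      have h1 := hΩconv.norm_image_sub_le_of_norm_fderiv_le (𝕜 := ℝ)
        (f := fun w => ∑ j, r j * ψ j w) (C := S)
        (fun z _ => (hcd.differentiable one_ne_zero) z)
        (fun z hz => by
          rw [← toDual_gradient, LinearIsometryEquiv.norm_map]
          exact hS r hr1 z hz) (hsub ω hω hy) (hsub ω hω hx)
      have h2 : ‖x - y‖ ≤ h := by
        rw [← dist_eq_norm]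
        exact (Metric.dist_le_diam_of_mem (hΩc.isBounded.subset (hsub ω hω)) hx hy).trans
          (hM_diam ω hω)
      rw [Real.norm_eq_abs] at h1
      refine h1.trans ?_
      rw [mul_comm h S]
      gcongr)
    rw [hlin ν hν0, hlin μstar hμΩ, ← Finset.sum_sub_distrib] at hb
    have e : ∑ j, (r j * A ν j - r j * A μstar j) = ‖v‖ := by
      have e1 : ∑ j, (r j * A ν j - r j * A μstar j) = inner ℝ r v := by
        rw [PiLp.inner_apply]
        refine Finset.sum_congr rfl fun j _ => ?_
        simp [hvd]; ring
      rw [e1, hr, real_inner_smul_left, real_inner_self_eq_norm_sq]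
      field_simp
    rw [e, abs_of_nonneg (norm_nonneg _)] at hb
    exact hb
  refine ⟨hi, hii, ?_⟩
  have h3 := aux_f f f' hf' hf'_lip (A μstar - b) (A ν - b) _
    (by simpa using hii)
  have h4 := mul_le_mul_of_nonneg_left hi hlam
  rw [hE, hE]
  linarith
end

section
/- Let (V, ‖·‖) be a real normed space and E : V → ℝ a convex function whose infimum m := inf_{u∈V} E(u) is finite. Suppose there are R > 0 and ε₀ > 0 such that every u ∈ V with E(u) ≤ m + ε₀ satisfies ‖u‖ ≤ R. Let W ⊆ V be a linear subspace with inf_{u∈W} E(u) ≤ m + η for some 0 ≤ η < ε₀, let z ∈ W with ‖z‖ ≤ R, and suppose there is a linear functional v on W such that E(u) ≥ E(z) + v(u − z) for all u ∈ W and |v(u − ũ)| ≤ η·‖u − ũ‖ for all u, ũ ∈ W. Then E(z) − m ≤ (1 + 2R)·η. -/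
/-- **Small discrete gradient refinement criterion** (Lemma `practical refinement criteria`,
case (4)): if sublevel sets near the infimum are bounded by `R`, `W` is a subspace whose
discrete infimum is within `η` of `m`, `z ∈ W` with `‖z‖ ≤ R`, and `v` is a subgradient of
`E|_W` at `z` with `|v(u − u')| ≤ η‖u − u'‖` on `W`, then `E(z) − m ≤ (1 + 2R)η`. -/
theorem stmt_11
    {V : Type*} [NormedAddCommGroup V] [NormedSpace ℝ V]
    (E : V → ℝ) (hE_conv : ConvexOn ℝ Set.univ E)
    (hE_bdd : BddBelow (Set.range E))
    (m : ℝ) (hm : m = ⨅ u, E u)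
    (R ε₀ : ℝ) (hR : 0 < R) (hε₀ : 0 < ε₀)
    (hlevel : ∀ u : V, E u ≤ m + ε₀ → ‖u‖ ≤ R)
    (η : ℝ) (hη0 : 0 ≤ η) (hηε : η < ε₀)
    (W : Subspace ℝ V)
    (hW_inf : ⨅ u : W, E u ≤ m + η)
    (z : W) (hz : ‖(z : V)‖ ≤ R)
    (v : W →ₗ[ℝ] ℝ)
    (hv_sub : ∀ u : W, E z + v (u - z) ≤ E u)
    (hv_bound : ∀ u u' : W, |v (u - u')| ≤ η * ‖(u : V) - (u' : V)‖) :
    E z - m ≤ (1 + 2 * R) * η := by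
  apply le_of_forall_pos_lt_add
  intro δ hδ
  have hpos : 0 < min δ (ε₀ - η) := lt_min hδ (by linarith)
  have hlt : (⨅ u : W, E u) < m + η + min δ (ε₀ - η) := by linarith
  obtain ⟨u, hu⟩ := exists_lt_of_ciInf_lt hlt
  have h1 := min_le_left δ (ε₀ - η)
  have h2 := min_le_right δ (ε₀ - η)
  have huR : ‖(u : V)‖ ≤ R := hlevel u (by linarith)
  have h3 := hv_sub u
  have h4 := neg_le_of_abs_le (hv_bound u z)
  have h5 : ‖(u : V) - (z : V)‖ ≤ 2 * R := by
    have := norm_sub_le (u : V) (z : V)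
    linarith
  have h6 := mul_le_mul_of_nonneg_left h5 hη0
  linarith
end

section
/- Let (t_n)_{n≥1} be a sequence of reals with t_n ≥ 1 for all n ≥ 1 and t_{n+1}² − t_{n+1} ≤ t_n² for all n ≥ 1. Then t_n ≤ n − 1 + t_1 for all n ≥ 1. -/
/-- **Upper bound on FISTA stepsizes** (Lemma `tn upper bound`): if `t_n ≥ 1` and
`t_{n+1}² − t_{n+1} ≤ t_n²` for all `n ≥ 1`, then `t_n ≤ n − 1 + t_1` for all `n ≥ 1`. -/
theorem stmt_12
    (t : ℕ → ℝ) (ht1 : ∀ n : ℕ, 1 ≤ n → 1 ≤ t n)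
    (hrec : ∀ n : ℕ, 1 ≤ n → (t (n + 1)) ^ 2 - t (n + 1) ≤ (t n) ^ 2) :
    ∀ n : ℕ, 1 ≤ n → t n ≤ (n : ℝ) - 1 + t 1 := by
  intro n hn
  induction n, hn using Nat.le_induction with
  | base => simp
  | succ k hk ih =>
    have h1 := ht1 k hk
    have h2 := hrec k hk
    have h3 : t (k + 1) ≤ t k + 1 := by
      by_contra h
      push Not at h
      nlinarith
    push_cast
    linarith
end

section
/- Let d, m ≥ 1 be integers, q > 0, δ := √d / 2, and let p : ℝ → ℝ be a polynomial with nonnegative coefficients. Then for every x ∈ [−m, m]^d, Σ over j ∈ ℤ^d with ‖j‖_∞ ≤ m of p(‖j − x‖₂)·exp(−q·‖j − x‖₂² / 2) ≤ Σ over j ∈ ℤ^d with ‖j‖_∞ ≤ 2m of p(‖j‖₂ + δ)·exp(−q·max(0, ‖j‖₂ − δ)² / 2). -/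
theorem aux_poly (p : Polynomial ℝ) (hp : ∀ i : ℕ, 0 ≤ p.coeff i) {a b : ℝ} (ha : 0 ≤ a)
    (hab : a ≤ b) : p.eval a ≤ p.eval b := by
  rw [Polynomial.eval_eq_sum_range, Polynomial.eval_eq_sum_range]
  exact Finset.sum_le_sum fun i _ => mul_le_mul_of_nonneg_left (pow_le_pow_left₀ ha hab i) (hp i)

theorem aux_poly0 (p : Polynomial ℝ) (hp : ∀ i : ℕ, 0 ≤ p.coeff i) {a : ℝ} (ha : 0 ≤ a) :
    0 ≤ p.eval a := by
  rw [Polynomial.eval_eq_sum_range]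
  exact Finset.sum_nonneg fun i _ => mul_nonneg (hp i) (pow_nonneg ha i)

theorem aux_tri (d : ℕ) (u v : Fin d → ℝ) (h : ∀ i, |u i - v i| ≤ 1 / 2) :
    √(∑ i, u i ^ 2) ≤ √(∑ i, v i ^ 2) + √d / 2 := by
  have h1 : ∀ w : Fin d → ℝ, √(∑ i, w i ^ 2) = ‖WithLp.toLp 2 w‖ := by
    intro w
    simp [EuclideanSpace.norm_eq]
  have h2 : √(∑ i, (u - v) i ^ 2) ≤ √d / 2 := by
    apply Real.sqrt_le_iff.2
    refine ⟨by positivity, ?_⟩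
    rw [div_pow, Real.sq_sqrt (Nat.cast_nonneg d)]
    calc ∑ i, (u - v) i ^ 2 ≤ ∑ i : Fin d, (1 / 4 : ℝ) := by
          refine Finset.sum_le_sum fun i _ => ?_
          have := abs_le.1 (h i)
          simp only [Pi.sub_apply]
          nlinarith
      _ = (d : ℝ) / 2 ^ 2 := by simp; ring
  rw [h1] at h2 ⊢
  rw [h1]
  have h3 : WithLp.toLp 2 u = WithLp.toLp 2 v + WithLp.toLp 2 (u - v) := by
    rw [← WithLp.toLp_add]; simp
  rw [h3]
  exact (norm_add_le _ _).trans (by linarith)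

/-- **Lattice Gaussian sum comparison** (Lemma `exp sum bound`): for `q > 0`, a polynomial `p`
with nonnegative coefficients, `δ = √d/2`, and `x ∈ [−m,m]^d`,
`Σ_{‖j‖_∞ ≤ m} p(‖j−x‖₂) e^{−q‖j−x‖₂²/2}
  ≤ Σ_{‖j‖_∞ ≤ 2m} p(‖j‖₂+δ) e^{−q·max(0,‖j‖₂−δ)²/2}`. -/
theorem stmt_14
    (d mm : ℕ) (hd : 1 ≤ d) (hm : 1 ≤ mm) (q : ℝ) (hq : 0 < q)
    (p : Polynomial ℝ) (hp : ∀ i : ℕ, 0 ≤ p.coeff i)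
    (x : Fin d → ℝ) (hx : ∀ i, |x i| ≤ (mm : ℝ)) :
    ∑ j ∈ Fintype.piFinset (fun _ : Fin d => Finset.Icc (-(mm : ℤ)) (mm : ℤ)),
        p.eval (Real.sqrt (∑ i, ((j i : ℝ) - x i) ^ 2)) *
          Real.exp (-q * (∑ i, ((j i : ℝ) - x i) ^ 2) / 2)
      ≤ ∑ j ∈ Fintype.piFinset (fun _ : Fin d => Finset.Icc (-(2 * mm : ℤ)) (2 * mm : ℤ)),
          p.eval (Real.sqrt (∑ i, ((j i : ℝ)) ^ 2) + Real.sqrt d / 2) *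
            Real.exp (-q * (max 0 (Real.sqrt (∑ i, ((j i : ℝ)) ^ 2) - Real.sqrt d / 2)) ^ 2 / 2) := by
  set k : Fin d → ℤ := fun i => round (x i) with hk
  have hkx : ∀ i, |x i - k i| ≤ 1 / 2 := fun i => abs_sub_round (x i)
  have hkm : ∀ i, -(mm : ℤ) ≤ k i ∧ k i ≤ mm := by
    intro i
    have h1 := abs_le.1 (hkx i)
    have h2 := abs_le.1 (hx i)
    constructor
    · have : (-(mm : ℤ) - 1 : ℝ) < k i := by push_cast; linarith
      have : -(mm : ℤ) - 1 < k i := by exact_mod_cast this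
      omega
    · have : (k i : ℝ) < (mm : ℤ) + 1 := by push_cast; linarith
      have : k i < (mm : ℤ) + 1 := by exact_mod_cast this
      omega
  set g : (Fin d → ℤ) → ℝ := fun j =>
    p.eval (Real.sqrt (∑ i, ((j i : ℝ)) ^ 2) + Real.sqrt d / 2) *
      Real.exp (-q * (max 0 (Real.sqrt (∑ i, ((j i : ℝ)) ^ 2) - Real.sqrt d / 2)) ^ 2 / 2) with hg
  have hg0 : ∀ j, 0 ≤ g j := fun j =>
    mul_nonneg (aux_poly0 p hp (by positivity)) (Real.exp_pos _).le
  have hinj : Function.Injective (fun j : Fin d → ℤ => j - k) := sub_left_injective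
  calc _ ≤ ∑ j ∈ Fintype.piFinset (fun _ : Fin d => Finset.Icc (-(mm : ℤ)) (mm : ℤ)),
        g (j - k) := by
        refine Finset.sum_le_sum fun j _ => ?_
        have t1 := aux_tri d (fun i => (j i : ℝ) - x i) (fun i => (((j - k) i : ℤ) : ℝ)) (by
          intro i
          have := hkx i
          rw [abs_sub_comm] at this
          convert this using 2
          simp)
        have t2 := aux_tri d (fun i => (((j - k) i : ℤ) : ℝ)) (fun i => (j i : ℝ) - x i) (by
          intro i
          convert hkx i using 2
          simp)
        refine mul_le_mul (aux_poly p hp (Real.sqrt_nonneg _) t1) ?_ (Real.exp_pos _).le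
          (aux_poly0 p hp (by positivity))
        apply Real.exp_le_exp.2
        have hs : 0 ≤ ∑ i, ((j i : ℝ) - x i) ^ 2 := Finset.sum_nonneg fun i _ => sq_nonneg _
        have t3 : max 0 (√(∑ i, (((j - k) i : ℤ) : ℝ) ^ 2) - √d / 2) ^ 2
            ≤ ∑ i, ((j i : ℝ) - x i) ^ 2 := by
          rw [← Real.sq_sqrt hs]
          exact pow_le_pow_left₀ (le_max_left _ _)
            (max_le (Real.sqrt_nonneg _) (by linarith)) 2
        have := mul_le_mul_of_nonneg_left t3 hq.le
        linarith
    _ = ∑ j ∈ (Fintype.piFinset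
          (fun _ : Fin d => Finset.Icc (-(mm : ℤ)) (mm : ℤ))).image (fun j => j - k), g j := by
        rw [Finset.sum_image (fun a _ b _ h => hinj h)]
    _ ≤ ∑ j ∈ Fintype.piFinset (fun _ : Fin d => Finset.Icc (-(2 * mm : ℤ)) (2 * mm : ℤ)),
        g j := by
        refine Finset.sum_le_sum_of_subset_of_nonneg ?_ fun j _ _ => hg0 j
        intro j hj
        obtain ⟨l, hl, rfl⟩ := Finset.mem_image.1 hj
        rw [Fintype.mem_piFinset] at hl ⊢
        intro i
        have h1 := Finset.mem_Icc.1 (hl i)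
        have h2 := hkm i
        simp only [Finset.mem_Icc, Pi.sub_apply]
        omega
end

section
/- Let Ω := [0,1]^d with Lebesgue measure, let μ be a finite signed Borel measure on Ω, and let M be a finite Borel partition of Ω into sets of positive Lebesgue measure, each of diameter at most h. Let ν be the measure on Ω with Lebesgue density Σ_{ω∈M} (μ(ω)/|ω|)·1_ω. Then for every continuously differentiable φ : Ω → ℝ, |∫_Ω φ dν − ∫_Ω φ dμ| ≤ h·‖∇φ‖_{L^∞(Ω)}·|μ|(Ω). -/
open MeasureTheory

theorem aux_cell_s17 {α : Type*} [MeasurableSpace α] (V P : Measure α) [IsFiniteMeasure P]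
    (ω : Set α) (hω : MeasurableSet ω) (hV0 : 0 < V ω) (hV1 : V ω < ⊤) (φ : α → ℝ) (C : ℝ)
    (hφV : IntegrableOn φ ω V) (hφP : IntegrableOn φ ω P)
    (hC : ∀ x ∈ ω, ∀ y ∈ ω, |φ x - φ y| ≤ C) :
    |P.real ω / (V ω).toReal * ∫ x in ω, φ x ∂V - ∫ x in ω, φ x ∂P| ≤ C * P.real ω := by
  have hv : 0 < V.real ω := ENNReal.toReal_pos hV0.ne' hV1.ne
  change |P.real ω / V.real ω * ∫ x in ω, φ x ∂V - ∫ x in ω, φ x ∂P| ≤ C * P.real ω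
  set a := (∫ x in ω, φ x ∂V) / V.real ω with ha
  have h1 : ∀ x ∈ ω, ‖a - φ x‖ ≤ C := by
    intro x hx
    have h2 : ‖∫ y in ω, (φ y - φ x) ∂V‖ ≤ C * V.real ω :=
      norm_setIntegral_le_of_norm_le_const hV1 (fun y hy => hC y hy x hx)
    rw [integral_sub hφV (integrableOn_const hV1.ne), setIntegral_const] at h2
    have h3 : a - φ x = ((∫ y in ω, φ y ∂V) - V.real ω • φ x) / V.real ω := by
      rw [ha, smul_eq_mul]; field_simp
    rw [h3, norm_div, Real.norm_of_nonneg hv.le, div_le_iff₀ hv]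
    exact h2
  have h4 := norm_setIntegral_le_of_norm_le_const (μ := P) (measure_lt_top P ω) h1
  rw [integral_sub (integrable_const a) hφP, setIntegral_const] at h4
  rw [Real.norm_eq_abs, smul_eq_mul] at h4
  convert h4 using 3
  rw [ha]; ring

theorem aux_part {α : Type*} [MeasurableSpace α] (V P : Measure α) [IsFiniteMeasure P]
    (M : Finset (Set α)) (Ω : Set α) (hM_meas : ∀ ω ∈ M, MeasurableSet ω)
    (hP : P Ωᶜ = 0)
    (hV0 : ∀ ω ∈ M, 0 < V ω) (hV1 : ∀ ω ∈ M, V ω < ⊤) (φ : α → ℝ) (C : ℝ)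
    (hM_disj : ∀ ω ∈ M, ∀ ω' ∈ M, ω ≠ ω' → Disjoint ω ω')
    (hM_cover : ⋃ ω ∈ M, ω = Ω)
    (hφV : ∀ ω ∈ M, IntegrableOn φ ω V) (hφP : ∀ ω ∈ M, IntegrableOn φ ω P)
    (hC : ∀ ω ∈ M, ∀ x ∈ ω, ∀ y ∈ ω, |φ x - φ y| ≤ C) :
    |∑ ω ∈ M, P.real ω / (V ω).toReal * ∫ x in ω, φ x ∂V - ∫ x, φ x ∂P| ≤ C * P.real Ω := by
  have hd : Set.PairwiseDisjoint (↑M) (fun ω : Set α => ω) := fun a ha b hb hab =>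
    hM_disj a ha b hb hab
  have h1 : ∫ x, φ x ∂P = ∑ ω ∈ M, ∫ x in ω, φ x ∂P := by
    rw [← integral_biUnion_finset M hM_meas hd hφP, hM_cover,
      Measure.restrict_eq_self_of_ae_mem (mem_ae_iff.2 hP)]
  have h2 : P.real Ω = ∑ ω ∈ M, P.real ω := by
    rw [← hM_cover]
    exact measureReal_biUnion_finset hd hM_meas
  rw [h1, h2, ← Finset.sum_sub_distrib, Finset.mul_sum]
  refine (Finset.abs_sum_le_sum_abs _ _).trans (Finset.sum_le_sum fun ω hω => ?_)
  exact aux_cell_s17 V P ω (hM_meas ω hω) (hV0 ω hω) (hV1 ω hω) φ C (hφV ω hω) (hφP ω hω) (hC ω hω)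

theorem aux_density {α : Type*} [MeasurableSpace α] (V : Measure α) (ρ φ : α → ℝ)
    (hρ : Measurable ρ) (hφ : Measurable φ) (hρi : Integrable ρ V)
    (hi : Integrable (fun x => ρ x * φ x) V) :
    signedIntegral (V.withDensityᵥ ρ) φ = ∫ x, ρ x * φ x ∂V := by
  have i1 := isFiniteMeasure_withDensity_ofReal hρi.2
  have i2 := isFiniteMeasure_withDensity_ofReal hρi.neg.2
  have hj : SignedMeasure.toJordanDecomposition (V.withDensityᵥ ρ) =
      @JordanDecomposition.mk α _ (V.withDensity fun x => ENNReal.ofReal (ρ x))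
        (V.withDensity fun x => ENNReal.ofReal (-ρ x)) i1 i2
        (withDensity_ofReal_mutuallySingular hρ) := by
    apply SignedMeasure.toJordanDecomposition_eq
    exact withDensityᵥ_eq_withDensity_pos_part_sub_withDensity_neg_part hρi
  unfold signedIntegral
  rw [hj]
  dsimp only
  rw [integral_withDensity_eq_integral_toReal_smul (by fun_prop) (by simp),
    integral_withDensity_eq_integral_toReal_smul (by fun_prop) (by simp), ← integral_sub]
  · congr 1
    ext x
    simp only [ENNReal.toReal_ofReal', smul_eq_mul]
    rcases le_total (ρ x) 0 with h | h
    · rw [max_eq_right h, max_eq_left (by linarith)]; ring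
    · rw [max_eq_left h, max_eq_right (by linarith)]; ring
  · refine hi.mono (by fun_prop) (Filter.Eventually.of_forall fun x => ?_)
    simp only [ENNReal.toReal_ofReal', smul_eq_mul, norm_mul, Real.norm_eq_abs]
    gcongr ?_ * _
    rcases le_total (ρ x) 0 with h | h
    · rw [max_eq_right h]; simp
    · rw [max_eq_left h]
  · refine hi.mono (by fun_prop) (Filter.Eventually.of_forall fun x => ?_)
    simp only [ENNReal.toReal_ofReal', smul_eq_mul, norm_mul, Real.norm_eq_abs]
    gcongr ?_ * _
    rcases le_total (ρ x) 0 with h | h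
    · rw [max_eq_left (by linarith), abs_neg]
    · rw [max_eq_right (by linarith)]; simp

/-- **Piecewise-constant averaging error** (the key estimate of Section 5.1): if `ν` is the
piecewise-constant averaging of the finite signed measure `μ` on a partition `M` of
`Ω = [0,1]^d` into cells of diameter at most `h`, then for every `C¹` function `φ`,
`|∫φ dν − ∫φ dμ| ≤ h ‖∇φ‖_{L^∞(Ω)} |μ|(Ω)`. -/
theorem stmt_17
    (d : ℕ) (hd : 0 < d)
    (Ω : Set (EuclideanSpace ℝ (Fin d)))
    (hΩ : Ω = {x : EuclideanSpace ℝ (Fin d) | ∀ i, x i ∈ Set.Icc (0 : ℝ) 1})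
    (μ : SignedMeasure (EuclideanSpace ℝ (Fin d)))
    (hμΩ : μ.totalVariation Ωᶜ = 0)
    (M : Finset (Set (EuclideanSpace ℝ (Fin d)))) (h : ℝ) (hh : 0 ≤ h)
    (hM_meas : ∀ ω ∈ M, MeasurableSet ω)
    (hM_pos : ∀ ω ∈ M, 0 < volume ω)
    (hM_diam : ∀ ω ∈ M, Metric.diam ω ≤ h)
    (hM_disj : ∀ ω ∈ M, ∀ ω' ∈ M, ω ≠ ω' → Disjoint ω ω')
    (hM_cover : ⋃ ω ∈ M, ω = Ω)
    (ρ : EuclideanSpace ℝ (Fin d) → ℝ)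
    (hρ : ∀ z, ρ z = ∑ ω ∈ M, (μ ω / (volume ω).toReal) * Set.indicator ω 1 z)
    (ν : SignedMeasure (EuclideanSpace ℝ (Fin d)))
    (hν : ν = volume.withDensityᵥ ρ)
    (φ : EuclideanSpace ℝ (Fin d) → ℝ) (hφ : ContDiff ℝ 1 φ)
    (G : ℝ) (hG : ∀ z ∈ Ω, ‖gradient φ z‖ ≤ G) :
    |signedIntegral ν φ - signedIntegral μ φ| ≤ h * G * (μ.totalVariation Ω).toReal := by
  have hconv : Convex ℝ Ω := by
    rw [hΩ]
    intro x hx y hy a b ha hb hab i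
    have := (convex_Icc (0:ℝ) 1) (hx i) (hy i) ha hb hab
    simpa using this
  have hcomp : IsCompact Ω := by
    have h1 : IsCompact (Set.univ.pi fun _ : Fin d => Set.Icc (0:ℝ) 1) :=
      isCompact_univ_pi fun _ => isCompact_Icc
    have h2 := h1.image (PiLp.continuous_toLp 2 (fun _ : Fin d => ℝ))
    convert h2
    rw [hΩ]
    ext x
    constructor
    · intro hx
      exact ⟨x.ofLp, fun i _ => hx i, rfl⟩
    · rintro ⟨y, hy, rfl⟩ i
      exact hy i trivial
  have hG0 : 0 ≤ G := by
    refine (norm_nonneg _).trans (hG 0 ?_)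
    rw [hΩ]; intro i; simp
  have hsub : ∀ ω ∈ M, ω ⊆ Ω := fun ω hω => by
    rw [← hM_cover]; exact Set.subset_biUnion_of_mem (u := fun ω => ω) hω
  have hdφ : Differentiable ℝ φ := hφ.differentiable (by norm_num)
  have hC : ∀ ω ∈ M, ∀ x ∈ ω, ∀ y ∈ ω, |φ x - φ y| ≤ h * G := by
    intro ω hω x hx y hy
    have h1 := hconv.norm_image_sub_le_of_norm_fderiv_le (f := φ) (𝕜 := ℝ) (C := G)
      (fun z _ => hdφ z) (fun z hz => by
        have := hG z hz
        rwa [gradient, LinearIsometryEquiv.norm_map] at this)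
      (hsub ω hω hy) (hsub ω hω hx)
    have h2 : ‖x - y‖ ≤ h := by
      rw [← dist_eq_norm]
      exact (Metric.dist_le_diam_of_mem (hcomp.isBounded.subset (hsub ω hω)) hx hy).trans
        (hM_diam ω hω)
    calc |φ x - φ y| ≤ G * ‖x - y‖ := h1
      _ ≤ G * h := by gcongr
      _ = h * G := mul_comm _ _
  have hV1 : ∀ ω ∈ M, volume ω < ⊤ := fun ω hω =>
    (measure_mono (hsub ω hω)).trans_lt hcomp.measure_lt_top
  have hcont : Continuous φ := hφ.continuous
  have hint : ∀ (P : Measure (EuclideanSpace ℝ (Fin d))) [IsFiniteMeasureOnCompacts P],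
      ∀ ω ∈ M, IntegrableOn φ ω P := fun P _ ω hω =>
    (hcont.continuousOn.integrableOn_compact hcomp).mono_set (hsub ω hω)
  have hρ' : ρ = fun z => ∑ ω ∈ M, (μ ω / (volume ω).toReal) * Set.indicator ω 1 z := funext hρ
  have hρm : Measurable ρ := by
    rw [hρ']
    refine Finset.measurable_sum _ fun ω hω => Measurable.const_mul ?_ _
    exact measurable_one.indicator (hM_meas ω hω)
  have hρi : Integrable ρ volume := by
    rw [hρ']
    refine integrable_finsetSum _ fun ω hω => Integrable.const_mul ?_ _
    exact (integrable_indicator_iff (hM_meas ω hω)).2 (integrableOn_const (hV1 ω hω).ne)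
  have hρφ : (fun x => ρ x * φ x) = fun z => ∑ ω ∈ M, (μ ω / (volume ω).toReal) *
      Set.indicator ω φ z := by
    ext z
    rw [hρ, Finset.sum_mul]
    refine Finset.sum_congr rfl fun ω _ => ?_
    by_cases hz : z ∈ ω <;> simp [hz]
  have hterm : ∀ ω ∈ M, Integrable (fun z => (μ ω / (volume ω).toReal) *
      Set.indicator ω φ z) volume := fun ω hω =>
    ((integrable_indicator_iff (hM_meas ω hω)).2 (hint volume ω hω)).const_mul _
  have hν1 : signedIntegral ν φ =
      ∑ ω ∈ M, (μ ω / (volume ω).toReal) * ∫ x in ω, φ x := by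
    rw [hν, aux_density volume ρ φ hρm hcont.measurable hρi
      (by rw [hρφ]; exact integrable_finsetSum _ hterm), hρφ, integral_finsetSum _ hterm]
    refine Finset.sum_congr rfl fun ω hω => ?_
    rw [integral_const_mul, integral_indicator (hM_meas ω hω)]
  set P := μ.toJordanDecomposition.posPart with hPdef
  set N := μ.toJordanDecomposition.negPart with hNdef
  have htv : μ.totalVariation = P + N := rfl
  have hμ : ∀ ω ∈ M, μ ω = P.real ω - N.real ω := by
    intro ω hω
    conv_lhs => rw [← SignedMeasure.toSignedMeasure_toJordanDecomposition μ]
    exact Measure.toSignedMeasure_sub_apply (hM_meas ω hω)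
  rw [htv, Measure.add_apply, add_eq_zero] at hμΩ
  have hP := aux_part volume P M Ω hM_meas hμΩ.1 hM_pos hV1 φ (h * G) hM_disj hM_cover
    (hint _) (hint _) hC
  have hN := aux_part volume N M Ω hM_meas hμΩ.2 hM_pos hV1 φ (h * G) hM_disj hM_cover
    (hint _) (hint _) hC
  have hsum : signedIntegral ν φ = (∑ ω ∈ M, P.real ω / (volume ω).toReal * ∫ x in ω, φ x) -
      ∑ ω ∈ M, N.real ω / (volume ω).toReal * ∫ x in ω, φ x := by
    rw [hν1, ← Finset.sum_sub_distrib]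
    refine Finset.sum_congr rfl fun ω hω => ?_
    rw [hμ ω hω]; ring
  have htot : (μ.totalVariation Ω).toReal = P.real Ω + N.real Ω := by
    rw [htv]; exact measureReal_add_apply
  have hμφ : signedIntegral μ φ = ∫ x, φ x ∂P - ∫ x, φ x ∂N := rfl
  rw [hsum, htot, hμφ, mul_add]
  rw [abs_le] at *
  constructor <;> linarith [hP.1, hP.2, hN.1, hN.2]
end
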